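/- Let r ≥ 1 be an integer, let 0 < α < 1/2, 0 < β < 1, K > 1, and p_0 < 1, and set γ := β²/(300Kr), τ := αγ(1−p_0), λ := τ/(2r), and V_0 := 8r²/τ. Let H be a weighted r-uniform hypergraph on a finite set V, let p ∈ (0, p_0], let η ≥ 0, suppose Δ_s(H) ≤ K·(λp)^{s−1}·e(H)/v(H) for every s ∈ {1,…,r}, and let Y = (Y_v)_{v∈V} be the indicator vector of the p-random subset R of V conditioned on the event e(H[R]) ≤ η·p^r·e(H). If W ⊆ V satisfies E(W) > β·e(H) and |V \ W| ≥ V_0/2, then there exists W' ⊆ V \ W with |W'| ≤ τ·|V| such that H(W ∪ W') ≥ H(W) + γ·p·|V|. -/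

import Mathlib

open Classical

noncomputable section

/-- The probability of the configuration `ω ⊆ V` under the product measure in which
each vertex `v` is retained independently with probability `q v`. -/
def pw {V : Type*} [Fintype V] [DecidableEq V] (q : V → ℝ) (ω : Finset V) : ℝ :=
  (∏ v ∈ ω, q v) * ∏ v ∈ ωᶜ, (1 - q v)

/-- The relative entropy `i_p(q) = D_KL(Ber(q) ‖ Ber(p))`.  (In Lean `Real.log 0 = 0`,
which implements the convention `0 · log 0 = 0`.) -/
def ip (p q : ℝ) : ℝ :=
  q * Real.log (q / p) + (1 - q) * Real.log ((1 - q) / (1 - p))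

/-- `e(H[ω])`: the total weight of the edges of the weighted hypergraph `(H, d)`
induced by the set `ω`. -/
def eInd {V : Type*} [DecidableEq V] (H : Finset (Finset V)) (d : Finset V → ℝ)
    (ω : Finset V) : ℝ :=
  ∑ A ∈ H, if A ⊆ ω then d A else 0

/-- `e(H)`: the total weight of the weighted hypergraph `(H, d)`. -/
def eTot {V : Type*} (H : Finset (Finset V)) (d : Finset V → ℝ) : ℝ :=
  ∑ A ∈ H, d A

/-- `deg_H B`: the total weight of the edges of `(H, d)` containing `B`. -/
def degH {V : Type*} [DecidableEq V] (H : Finset (Finset V)) (d : Finset V → ℝ)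
    (B : Finset V) : ℝ :=
  ∑ A ∈ H, if B ⊆ A then d A else 0

/-- The probability of the event `P` for the indicator vector `Y` of the `p`-random
subset `R` of `V` conditioned on the lower-tail event `e(H[R]) ≤ η p^r e(H)`. -/
def nuPr {V : Type*} [Fintype V] [DecidableEq V] (H : Finset (Finset V))
    (d : Finset V → ℝ) (r : ℕ) (p η : ℝ) (P : Finset V → Prop) : ℝ :=
  (∑ ω : Finset V,
      if P ω ∧ eInd H d ω ≤ η * p ^ r * eTot H d then pw (fun _ => p) ω else 0) /
    ∑ ω : Finset V,
      if eInd H d ω ≤ η * p ^ r * eTot H d then pw (fun _ => p) ω else 0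

/-- The conditional expectation `E_W[Y_B] = E[∏_{b ∈ B} Y_b ∣ (Y_w)_{w ∈ W} = 𝟙_s]`
for the conditioned indicator vector `Y`. -/
def condE {V : Type*} [Fintype V] [DecidableEq V] (H : Finset (Finset V))
    (d : Finset V → ℝ) (r : ℕ) (p η : ℝ) (W s B : Finset V) : ℝ :=
  nuPr H d r p η (fun ω => B ⊆ ω ∧ ω ∩ W = s) / nuPr H d r p η (fun ω => ω ∩ W = s)

/-- `D_W(B, b) = E_W[Y_B] − E_W[Y_{B∖{b}}] · E_W[Y_b]`, evaluated at
`(Y_w)_{w ∈ W} = 𝟙_s`. -/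
def DW {V : Type*} [Fintype V] [DecidableEq V] (H : Finset (Finset V))
    (d : Finset V → ℝ) (r : ℕ) (p η : ℝ) (W s B : Finset V) (b : V) : ℝ :=
  condE H d r p η W s B - condE H d r p η W s (B.erase b) * condE H d r p η W s {b}

/-- The quantity `𝓔(W)` from equation `eq:Err-W-def`:
`E[ ∑_{A ∈ H−W} ∑_{B ⊆ A, |B| ≥ 2} ∑_{b ∈ B} d_A D_W(B,b)² / (C(r,|B|)·|B|·p^{2|B|}) ]`,
where the expectation averages over the values `𝟙_s` of `(Y_w)_{w ∈ W}`. -/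
def errW {V : Type*} [Fintype V] [DecidableEq V] (H : Finset (Finset V))
    (d : Finset V → ℝ) (r : ℕ) (p η : ℝ) (W : Finset V) : ℝ :=
  ∑ s ∈ W.powerset, nuPr H d r p η (fun ω => ω ∩ W = s) *
    ∑ A ∈ H.filter (fun A => Disjoint A W),
      ∑ B ∈ A.powerset.filter (fun B => 2 ≤ B.card), ∑ b ∈ B,
        d A * (DW H d r p η W s B b) ^ 2 /
          ((r.choose B.card : ℝ) * (B.card : ℝ) * p ^ (2 * B.card))

/-- The quantity `H(W) = ∑_{v ∈ V∖W} I_p(Y_v ∣ (Y_w)_{w ∈ W})`, written out via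
`I_p(Y_v ∣ S) = ∑_s Pr(S = 𝟙_s) · i_p(Pr(Y_v = 1 ∣ S = 𝟙_s))`. -/
def HW {V : Type*} [Fintype V] [DecidableEq V] (H : Finset (Finset V))
    (d : Finset V → ℝ) (r : ℕ) (p η : ℝ) (W : Finset V) : ℝ :=
  ∑ v ∈ Wᶜ, ∑ s ∈ W.powerset,
    nuPr H d r p η (fun ω => ω ∩ W = s) * ip p (condE H d r p η W s {v})

section Weights

variable {V : Type*} [Fintype V] [DecidableEq V]

/-- The conditional probability, under the weights `ν`, that `B` is contained in the random
set `ω` given that `ω ∩ W = s`. -/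
def cexp (ν : Finset V → ℝ) (W s B : Finset V) : ℝ :=
  (∑ ω, if B ⊆ ω ∧ ω ∩ W = s then ν ω else 0) / ∑ ω, if ω ∩ W = s then ν ω else 0

theorem sum_powerset_fiber_mul (ν : Finset V → ℝ) (W : Finset V) (f : Finset V → ℝ) :
    ∑ s ∈ W.powerset, (∑ ω, if ω ∩ W = s then ν ω else 0) * f s =
      ∑ ω, ν ω * f (ω ∩ W) := by
  simp_rw [Finset.sum_mul]
  rw [Finset.sum_comm]
  refine Finset.sum_congr rfl fun ω _ => ?_
  simp_rw [ite_mul, zero_mul]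
  rw [Finset.sum_ite_eq, if_pos (Finset.mem_powerset.2 Finset.inter_subset_right)]

theorem fiber_mul_cexp (ν : Finset V → ℝ) (hν : ∀ ω, 0 ≤ ν ω) (W s B : Finset V) :
    (∑ ω, if ω ∩ W = s then ν ω else 0) * cexp ν W s B =
      ∑ ω, if B ⊆ ω ∧ ω ∩ W = s then ν ω else 0 := by
  unfold cexp
  by_cases h : (∑ ω, if ω ∩ W = s then ν ω else 0) = 0
  · rw [h, zero_mul]
    symm
    rw [Finset.sum_eq_zero_iff_of_nonneg (fun ω _ => by split_ifs <;> simp [hν])] at h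
    refine Finset.sum_eq_zero fun ω hω => ?_
    have := h ω hω
    split_ifs with h1
    · simpa [h1.2] using this
    · rfl
  · field_simp

/-- The tower property for functions of `ω ∩ W`. -/
theorem sum_mul_indicator_eq_sum_mul_cexp (ν : Finset V → ℝ) (hν : ∀ ω, 0 ≤ ν ω)
    (W B : Finset V) (g : Finset V → ℝ) :
    ∑ ω, ν ω * (g (ω ∩ W) * if B ⊆ ω then 1 else 0) =
      ∑ ω, ν ω * (g (ω ∩ W) * cexp ν W (ω ∩ W) B) := by
  rw [← sum_powerset_fiber_mul ν W (fun s => g s * cexp ν W s B)]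
  have h1 : ∀ s, (∑ ω, if ω ∩ W = s then ν ω else 0) * (g s * cexp ν W s B) =
      (∑ ω, if ω ∩ W = s then (ν ω * if B ⊆ ω then 1 else 0) else 0) * g s := by
    intro s
    rw [mul_left_comm, fiber_mul_cexp ν hν, mul_comm]
    congr 1
    refine Finset.sum_congr rfl fun ω _ => ?_
    by_cases h1 : B ⊆ ω <;> by_cases h2 : ω ∩ W = s <;> simp [h1, h2]
  simp_rw [h1]
  rw [sum_powerset_fiber_mul (fun ω => ν ω * if B ⊆ ω then 1 else 0) W g]
  exact Finset.sum_congr rfl fun ω _ => by ring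

/-- If `ν` is at most the `p`-biased odds on adding an element, then containing `b` has
probability at most `p` relative to any event closed under removing `b`. -/
theorem sum_mem_le_mul (ν : Finset V → ℝ) {p : ℝ}
    (hdown : ∀ ω b, b ∉ ω → (1 - p) * ν (insert b ω) ≤ p * ν ω)
    (b : V) (G : Finset V → Prop) [DecidablePred G]
    (hG : ∀ ω, b ∉ ω → G (insert b ω) → G ω) (hν : ∀ ω, 0 ≤ ν ω) (hp : 0 ≤ p) :
    (∑ ω, if b ∈ ω ∧ G ω then ν ω else 0) ≤ p * ∑ ω, if G ω then ν ω else 0 := by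
  have key : ∀ f : Finset V → ℝ, ∑ ω, f ω =
      ∑ ω ∈ (Finset.univ.erase b).powerset, (f ω + f (insert b ω)) := by
    intro f
    have h := Finset.sum_powerset_insert (Finset.notMem_erase b Finset.univ) f
    rw [Finset.insert_erase (Finset.mem_univ b), Finset.powerset_univ] at h
    rw [h, Finset.sum_add_distrib]
  rw [key, key, Finset.mul_sum]
  refine Finset.sum_le_sum fun ω hω => ?_
  have hb : b ∉ ω := fun h => by simpa using Finset.mem_powerset.1 hω h
  have h1 := hdown ω b hb
  have h2 := hG ω hb
  have h3 := hν ω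
  by_cases h4 : G (insert b ω)
  · simp only [hb, false_and, if_false, Finset.mem_insert_self, h4, h2 h4, and_self, if_true]
    linarith
  · simp only [hb, false_and, if_false, h4, and_false]
    split_ifs
    · simpa using mul_nonneg hp h3
    · simp

theorem sum_subset_le_pow_mul (ν : Finset V → ℝ) {p : ℝ}
    (hdown : ∀ ω b, b ∉ ω → (1 - p) * ν (insert b ω) ≤ p * ν ω)
    (G : Finset V → Prop) [DecidablePred G] (hν : ∀ ω, 0 ≤ ν ω) (hp : 0 ≤ p)
    (J : Finset V) (hG : ∀ b ∈ J, ∀ ω, b ∉ ω → G (insert b ω) → G ω) :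
    (∑ ω, if J ⊆ ω ∧ G ω then ν ω else 0) ≤ p ^ J.card * ∑ ω, if G ω then ν ω else 0 := by
  induction J using Finset.induction_on with
  | empty => simp
  | insert b J hb ih =>
    have h1 := sum_mem_le_mul ν hdown b (fun ω => J ⊆ ω ∧ G ω)
      (fun ω hω h => ⟨fun x hx => ((Finset.mem_insert.1 (h.1 hx)).resolve_left
        (fun h => hb (h ▸ hx))), hG b (Finset.mem_insert_self _ _) ω hω h.2⟩) hν hp
    have h2 := ih fun c hc => hG c (Finset.mem_insert_of_mem hc)
    rw [Finset.card_insert_of_notMem hb, pow_succ']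
    simp_rw [Finset.insert_subset_iff, and_assoc]
    calc _ ≤ _ := h1
      _ ≤ _ := by rw [mul_assoc]; exact mul_le_mul_of_nonneg_left h2 hp

theorem cexp_nonneg (ν : Finset V → ℝ) (hν : ∀ ω, 0 ≤ ν ω) (W s B : Finset V) :
    0 ≤ cexp ν W s B :=
  div_nonneg (Finset.sum_nonneg fun ω _ => by split_ifs <;> simp [hν])
    (Finset.sum_nonneg fun ω _ => by split_ifs <;> simp [hν])

theorem cexp_le_pow (ν : Finset V → ℝ) {p : ℝ}
    (hdown : ∀ ω b, b ∉ ω → (1 - p) * ν (insert b ω) ≤ p * ν ω)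
    (hν : ∀ ω, 0 ≤ ν ω) (hp : 0 ≤ p) (W s B : Finset V) (hB : Disjoint B W) :
    cexp ν W s B ≤ p ^ B.card := by
  refine div_le_of_le_mul₀ (Finset.sum_nonneg fun ω _ => by split_ifs <;> simp [hν])
    (by positivity) ?_
  refine sum_subset_le_pow_mul ν hdown (fun ω => ω ∩ W = s) hν hp B fun b hb ω _ h => ?_
  rwa [Finset.insert_inter_of_notMem (Finset.disjoint_left.1 hB hb)] at h

theorem abs_cexp_sub_le (ν : Finset V → ℝ) {p : ℝ}
    (hdown : ∀ ω b, b ∉ ω → (1 - p) * ν (insert b ω) ≤ p * ν ω)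
    (hν : ∀ ω, 0 ≤ ν ω) (hp : 0 ≤ p) (W s B : Finset V) (hB : Disjoint B W) {b : V}
    (hb : b ∈ B) :
    |cexp ν W s B - cexp ν W s (B.erase b) * cexp ν W s {b}| ≤ p ^ B.card := by
  have h1 := cexp_le_pow ν hdown hν hp W s B hB
  have h2 := cexp_le_pow ν hdown hν hp W s (B.erase b)
    (hB.mono_left (Finset.erase_subset _ _))
  have h3 := cexp_le_pow ν hdown hν hp W s {b}
    (hB.mono_left (Finset.singleton_subset_iff.2 hb))
  have h4 := mul_le_mul h2 h3 (cexp_nonneg ν hν _ _ _) (by positivity)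
  rw [← pow_add, Finset.card_singleton, Finset.card_erase_add_one hb] at h4
  have h5 := cexp_nonneg ν hν W s B
  have h6 := mul_nonneg (cexp_nonneg ν hν W s (B.erase b)) (cexp_nonneg ν hν W s {b})
  rw [abs_le]
  constructor <;> linarith

/-- Conditioning on more coordinates: the covariance of the updated probability of `b` with
the indicator of a revealed set `J`. -/
theorem sum_mul_cexp_sub_cexp (ν : Finset V → ℝ) (hν : ∀ ω, 0 ≤ ν ω) (W W' J : Finset V)
    (hJ : J ⊆ W') (b : V) (c : Finset V → ℝ) :
    ∑ ω, ν ω * ((cexp ν (W ∪ W') (ω ∩ (W ∪ W')) {b} - cexp ν W (ω ∩ W) {b}) *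
        (c (ω ∩ W) * if J ⊆ ω then 1 else 0)) =
      ∑ ω, ν ω * (c (ω ∩ W) * (cexp ν W (ω ∩ W) (insert b J) -
        cexp ν W (ω ∩ W) J * cexp ν W (ω ∩ W) {b})) := by
  have e1 : ∀ ω : Finset V, (ω ∩ (W ∪ W')) ∩ W = ω ∩ W := fun ω => by
    rw [Finset.inter_assoc, Finset.inter_eq_right.2 Finset.subset_union_left]
  have e2 : ∀ ω : Finset V, J ⊆ ω ∩ (W ∪ W') ↔ J ⊆ ω := fun ω =>
    ⟨fun h => h.trans Finset.inter_subset_left,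
      fun h => Finset.subset_inter h (hJ.trans Finset.subset_union_right)⟩
  have t1 := sum_mul_indicator_eq_sum_mul_cexp ν hν (W ∪ W') {b}
    (fun s => c (s ∩ W) * if J ⊆ s then 1 else 0)
  simp only [e1, e2] at t1
  have t2 := sum_mul_indicator_eq_sum_mul_cexp ν hν W (insert b J) c
  have t3 := sum_mul_indicator_eq_sum_mul_cexp ν hν W J (fun s => c s * cexp ν W s {b})
  have t4 : ∑ ω, ν ω * ((c (ω ∩ W) * if J ⊆ ω then 1 else 0) *
      if {b} ⊆ ω then 1 else 0) = ∑ ω, ν ω * (c (ω ∩ W) * if insert b J ⊆ ω then 1 else 0) :=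
    Finset.sum_congr rfl fun ω _ => by
      by_cases h1 : J ⊆ ω <;> by_cases h2 : b ∈ ω <;> simp [h1, h2, Finset.insert_subset_iff]
  have l : ∑ ω, ν ω * ((cexp ν (W ∪ W') (ω ∩ (W ∪ W')) {b} - cexp ν W (ω ∩ W) {b}) *
        (c (ω ∩ W) * if J ⊆ ω then 1 else 0)) =
      ∑ ω, ν ω * ((c (ω ∩ W) * if J ⊆ ω then 1 else 0) *
        cexp ν (W ∪ W') (ω ∩ (W ∪ W')) {b}) -
      ∑ ω, ν ω * (c (ω ∩ W) * cexp ν W (ω ∩ W) {b} * if J ⊆ ω then 1 else 0) := by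
    rw [← Finset.sum_sub_distrib]
    exact Finset.sum_congr rfl fun ω _ => by ring
  rw [l, ← t1, t4, t2, t3, ← Finset.sum_sub_distrib]
  exact Finset.sum_congr rfl fun ω _ => by ring

end Weights

/-- The binary relative entropy is strongly convex on `[0, p]`. -/
theorem convexOn_ip_sub_sq {p : ℝ} (hp : 0 < p) (hp1 : p < 1) :
    ConvexOn ℝ (Set.Icc 0 p) (fun x => ip p x - x ^ 2 / (2 * p)) := by
  have h1 : ConvexOn ℝ (Set.Icc 0 p) (fun x => x * Real.log x - x ^ 2 / (2 * p)) := by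
    refine convexOn_of_hasDerivWithinAt2_nonneg (f' := fun x => Real.log x + 1 - x / p)
      (f'' := fun x => 1 / x - 1 / p) (convex_Icc 0 p) ?_ ?_ ?_ ?_
    · exact (Real.continuous_mul_log.sub (by fun_prop)).continuousOn
    · intro x hx
      rw [interior_Icc] at hx
      have := (Real.hasDerivAt_mul_log hx.1.ne').sub
        (((hasDerivAt_id x).pow 2).div_const (2 * p))
      refine (this.congr_deriv ?_).hasDerivWithinAt
      simp
      field_simp
    · intro x hx
      rw [interior_Icc] at hx
      have := ((Real.hasDerivAt_log hx.1.ne').add_const 1).sub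
        ((hasDerivAt_id x).div_const p)
      refine (this.congr_deriv ?_).hasDerivWithinAt
      simp
    · intro x hx
      rw [interior_Icc] at hx
      exact sub_nonneg.2 (one_div_le_one_div_of_le hx.1 hx.2.le)
  have h2 : ConvexOn ℝ (Set.Icc 0 p) (fun x => (1 - x) * Real.log (1 - x)) := by
    have := Real.convexOn_mul_log.comp_affineMap
      (AffineMap.lineMap (1 : ℝ) (0 : ℝ) : ℝ →ᵃ[ℝ] ℝ)
    refine (this.subset (fun x hx => ?_) (convex_Icc 0 p)).congr (fun x _ => ?_)
    · simp only [Set.mem_preimage, AffineMap.lineMap_apply, Set.mem_Ici]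
      simp
      linarith [hx.2]
    · simp [AffineMap.lineMap_apply]
      ring_nf
  have h3 : ConvexOn ℝ (Set.Icc 0 p)
      (fun x => -(x * Real.log p) - (1 - x) * Real.log (1 - p)) := by
    refine ⟨convex_Icc 0 p, fun x _ y _ a b _ _ hab => le_of_eq ?_⟩
    simp only [smul_eq_mul]
    linear_combination Real.log (1 - p) * hab
  refine ((h1.add h2).add h3).congr fun x hx => ?_
  have e1 : x * Real.log (x / p) = x * Real.log x - x * Real.log p := by
    rcases eq_or_ne x 0 with h | h
    · simp [h]
    · rw [Real.log_div h hp.ne']; ring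
  have e2 : Real.log ((1 - x) / (1 - p)) = Real.log (1 - x) - Real.log (1 - p) :=
    Real.log_div (by linarith [hx.2]) (by linarith)
  simp only [Pi.add_apply, ip, e1, e2]
  ring

theorem ip_le_div {p q : ℝ} (hp : 0 < p) (hp1 : p < 1) (hq : 0 ≤ q) (hqp : q ≤ p) :
    ip p q ≤ p / (1 - p) := by
  have h1 : q * Real.log (q / p) ≤ 0 :=
    mul_nonpos_of_nonneg_of_nonpos hq
      (Real.log_nonpos (by positivity) ((div_le_one hp).2 hqp))
  have hq1 : 0 < 1 - q := by linarith
  have hpp : 0 < 1 - p := by linarith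
  have h2 : Real.log ((1 - q) / (1 - p)) ≤ (1 - q) / (1 - p) - 1 :=
    Real.log_le_sub_one_of_pos (by positivity)
  have h3 : (1 - q) / (1 - p) - 1 = (p - q) / (1 - p) := by field_simp; ring
  have h4 : (p - q) / (1 - p) ≤ p / (1 - p) := by gcongr; linarith
  have h5 : 0 ≤ (p - q) / (1 - p) := div_nonneg (by linarith) hpp.le
  unfold ip
  nlinarith

section Gain

variable {V : Type*} [Fintype V] [DecidableEq V]

theorem entropy_gain_of_test (ν : Finset V → ℝ) {p : ℝ}
    (hdown : ∀ ω b, b ∉ ω → (1 - p) * ν (insert b ω) ≤ p * ν ω)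
    (hν : ∀ ω, 0 ≤ ν ω) (hp : 0 < p) (hp1 : p < 1) (W W' : Finset V) {b : V}
    (hbW : b ∉ W) (hbW' : b ∉ W') (X : Finset V → ℝ) :
    1 / (2 * p) * (2 * ∑ ω, ν ω *
        ((cexp ν (W ∪ W') (ω ∩ (W ∪ W')) {b} - cexp ν W (ω ∩ W) {b}) * X ω) -
        ∑ ω, ν ω * X ω ^ 2) ≤
      ∑ ω, ν ω * ip p (cexp ν (W ∪ W') (ω ∩ (W ∪ W')) {b}) -
        ∑ ω, ν ω * ip p (cexp ν W (ω ∩ W) {b}) := by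
  set q' : Finset V → ℝ := fun ω => cexp ν (W ∪ W') (ω ∩ (W ∪ W')) {b} with hq'
  set q : Finset V → ℝ := fun s => cexp ν W s {b} with hq
  have hbound : ∀ U s : Finset V, b ∉ U → cexp ν U s {b} ∈ Set.Icc 0 p := fun U s hU =>
    ⟨cexp_nonneg ν hν _ _ _, by
      simpa using cexp_le_pow ν hdown hν hp.le U s {b} (by simpa using hU)⟩
  have hq'm : ∀ ω, q' ω ∈ Set.Icc 0 p := fun ω => hbound _ _ (by simp [hbW, hbW'])
  have e1 : ∀ ω : Finset V, (ω ∩ (W ∪ W')) ∩ W = ω ∩ W := fun ω => by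
    rw [Finset.inter_assoc, Finset.inter_eq_right.2 Finset.subset_union_left]
  have tower : ∀ g : Finset V → ℝ, ∑ ω, ν ω * (g (ω ∩ W) * q (ω ∩ W)) =
      ∑ ω, ν ω * (g (ω ∩ W) * q' ω) := by
    intro g
    have t1 := sum_mul_indicator_eq_sum_mul_cexp ν hν (W ∪ W') {b} (fun s => g (s ∩ W))
    have t2 := sum_mul_indicator_eq_sum_mul_cexp ν hν W {b} g
    simp only [e1] at t1
    rw [← t2, t1]
  set φ : ℝ → ℝ := fun x => ip p x - x ^ 2 / (2 * p) with hφ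
  have hconv : ConvexOn ℝ (Set.Icc 0 p) φ := convexOn_ip_sub_sq hp hp1
  have jensen : ∀ s, (∑ ω, if ω ∩ W = s then ν ω else 0) * φ (q s) ≤
      (∑ ω, if ω ∩ W = s then ν ω * φ (q' ω) else 0) * 1 := by
    intro s
    set M := ∑ ω, if ω ∩ W = s then ν ω else 0 with hM
    have hnn : ∀ ω, 0 ≤ if ω ∩ W = s then ν ω else 0 := fun ω => by
      split_ifs <;> simp [hν]
    rcases (Finset.sum_nonneg fun ω (_ : ω ∈ Finset.univ) => hnn ω).eq_or_lt' with h | h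
    · have h0 := (Finset.sum_eq_zero_iff_of_nonneg fun ω _ => hnn ω).1 h
      rw [hM, h, zero_mul, mul_one]
      refine (Finset.sum_eq_zero fun ω hω => ?_).ge
      have := h0 ω hω
      split_ifs with h1
      · rw [if_pos h1] at this
        rw [this, zero_mul]
      · rfl
    · rw [← hM] at h
      have hJ := hconv.map_sum_le (t := Finset.univ)
        (w := fun ω => (if ω ∩ W = s then ν ω else 0) / M) (p := q')
        (fun ω _ => div_nonneg (hnn ω) h.le)
        (by rw [← Finset.sum_div, ← hM, div_self h.ne']) (fun ω _ => hq'm ω)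
      have ht := tower fun s' => if s' = s then 1 else 0
      have hL : ∑ ω, ν ω * ((if ω ∩ W = s then 1 else 0) * q (ω ∩ W)) = M * q s := by
        rw [hM, Finset.sum_mul]
        refine Finset.sum_congr rfl fun ω _ => ?_
        by_cases h1 : ω ∩ W = s <;> simp [h1]
      have hmean : ∑ ω, ((if ω ∩ W = s then ν ω else 0) / M) • q' ω = q s := by
        rw [← mul_right_inj' h.ne', ← hL, ht, Finset.mul_sum]
        refine Finset.sum_congr rfl fun ω _ => ?_
        simp only [smul_eq_mul]
        by_cases h1 : ω ∩ W = s
        · simp only [h1, if_true]; field_simp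
        · simp [h1]
      rw [hmean] at hJ
      calc M * φ (q s) ≤ M * _ := mul_le_mul_of_nonneg_left hJ h.le
        _ = _ := by
          rw [Finset.mul_sum, mul_one]
          refine Finset.sum_congr rfl fun ω _ => ?_
          simp only [smul_eq_mul]
          by_cases h1 : ω ∩ W = s
          · simp only [h1, if_true]; field_simp
          · simp [h1]
  have hsum : ∑ ω, ν ω * φ (q (ω ∩ W)) ≤ ∑ ω, ν ω * φ (q' ω) := by
    have := Finset.sum_le_sum fun s (_ : s ∈ W.powerset) => jensen s
    rw [sum_powerset_fiber_mul ν W (fun s => φ (q s)),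
      sum_powerset_fiber_mul (fun ω => ν ω * φ (q' ω)) W (fun _ => 1)] at this
    simpa using this
  have hqq := tower q
  have hsq : ∑ ω, ν ω * (2 * ((q' ω - q (ω ∩ W)) * X ω) - X ω ^ 2) ≤
      ∑ ω, ν ω * (q' ω - q (ω ∩ W)) ^ 2 :=
    Finset.sum_le_sum fun ω _ => mul_le_mul_of_nonneg_left
      (by nlinarith [sq_nonneg (q' ω - q (ω ∩ W) - X ω)]) (hν ω)
  have hexp : ∑ ω, ν ω * (q' ω - q (ω ∩ W)) ^ 2 =
      ∑ ω, ν ω * q' ω ^ 2 - ∑ ω, ν ω * q (ω ∩ W) ^ 2 := by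
    have : ∑ ω, ν ω * (q' ω - q (ω ∩ W)) ^ 2 = ∑ ω, ν ω * q' ω ^ 2 -
        2 * ∑ ω, ν ω * (q (ω ∩ W) * q' ω) + ∑ ω, ν ω * (q (ω ∩ W) * q (ω ∩ W)) := by
      rw [Finset.mul_sum, ← Finset.sum_sub_distrib, ← Finset.sum_add_distrib]
      exact Finset.sum_congr rfl fun ω _ => by ring
    rw [this, ← hqq]
    have h2 : ∑ ω, ν ω * (q (ω ∩ W) * q (ω ∩ W)) = ∑ ω, ν ω * q (ω ∩ W) ^ 2 :=
      Finset.sum_congr rfl fun ω _ => by ring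
    rw [h2]; ring
  have hl : ∑ ω, ν ω * (2 * ((q' ω - q (ω ∩ W)) * X ω) - X ω ^ 2) =
      2 * ∑ ω, ν ω * ((q' ω - q (ω ∩ W)) * X ω) - ∑ ω, ν ω * X ω ^ 2 := by
    rw [Finset.mul_sum, ← Finset.sum_sub_distrib]
    exact Finset.sum_congr rfl fun ω _ => by ring
  have hφs : ∀ f : Finset V → ℝ, ∑ ω, ν ω * φ (f ω) =
      ∑ ω, ν ω * ip p (f ω) - 1 / (2 * p) * ∑ ω, ν ω * f ω ^ 2 := by
    intro f
    rw [Finset.mul_sum, ← Finset.sum_sub_distrib]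
    exact Finset.sum_congr rfl fun ω _ => by simp only [hφ]; ring
  rw [hφs q', hφs fun ω => q (ω ∩ W)] at hsum
  rw [hl, hexp] at hsq
  have := mul_le_mul_of_nonneg_left hsq (by positivity : 0 ≤ 1 / (2 * p))
  rw [mul_sub (1 / (2 * p)) (∑ ω, ν ω * q' ω ^ 2)] at this
  linarith

/-- The gain in relative entropy at `b` from revealing `W'`, tested against a linear
combination of the indicators of revealed sets. -/
theorem entropy_gain_of_indicators {ι : Type*} (ν : Finset V → ℝ) {p : ℝ}
    (hdown : ∀ ω b, b ∉ ω → (1 - p) * ν (insert b ω) ≤ p * ν ω)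
    (hν : ∀ ω, 0 ≤ ν ω) (hν1 : ∑ ω, ν ω = 1) (hp : 0 < p) (hp1 : p < 1)
    (W W' : Finset V) {b : V} (hbW : b ∉ W) (hbW' : b ∉ W') (I : Finset ι)
    (J : ι → Finset V) (c : ι → Finset V → ℝ) (C : ι → ℝ) (hc : ∀ x ∈ I, ∀ s, |c x s| ≤ C x) :
    1 / (2 * p) * (2 * ∑ x ∈ I, (if J x ⊆ W' then 1 else 0) * ∑ ω, ν ω * (c x (ω ∩ W) *
          (cexp ν W (ω ∩ W) (insert b (J x)) -
            cexp ν W (ω ∩ W) (J x) * cexp ν W (ω ∩ W) {b})) -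
        ∑ x ∈ I, ∑ y ∈ I, (if J x ∪ J y ⊆ W' then 1 else 0) *
          (C x * C y * p ^ (J x ∪ J y).card)) ≤
      ∑ ω, ν ω * ip p (cexp ν (W ∪ W') (ω ∩ (W ∪ W')) {b}) -
        ∑ ω, ν ω * ip p (cexp ν W (ω ∩ W) {b}) := by
  set X : Finset V → ℝ := fun ω => ∑ x ∈ I, (if J x ⊆ W' then 1 else 0) *
    (c x (ω ∩ W) * if J x ⊆ ω then 1 else 0) with hX
  refine le_trans ?_ (entropy_gain_of_test ν hdown hν hp hp1 W W' hbW hbW' X)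
  refine mul_le_mul_of_nonneg_left (sub_le_sub (le_of_eq ?_) ?_) (by positivity)
  · congr 1
    simp_rw [hX, Finset.mul_sum]
    rw [Finset.sum_comm (t := I)]
    refine Finset.sum_congr rfl fun x _ => ?_
    by_cases h : J x ⊆ W'
    · simpa only [h, if_true, one_mul] using
        (sum_mul_cexp_sub_cexp ν hν W W' (J x) h b (c x)).symm
    · simp [h]
  · have hmom : ∀ K : Finset V, ∑ ω, ν ω * (if K ⊆ ω then 1 else 0) ≤ p ^ K.card := by
      intro K
      have := sum_subset_le_pow_mul ν hdown (fun _ => True) hν hp.le K (fun _ _ _ _ _ => trivial)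
      simpa [hν1] using this
    have hexp : ∑ ω, ν ω * X ω ^ 2 = ∑ x ∈ I, ∑ y ∈ I, ∑ ω, ν ω *
        ((if J x ∪ J y ⊆ W' then 1 else 0) *
          (c x (ω ∩ W) * c y (ω ∩ W) * if J x ∪ J y ⊆ ω then 1 else 0)) := by
      simp_rw [hX, sq, Finset.sum_mul_sum, Finset.mul_sum]
      rw [Finset.sum_comm]
      refine Finset.sum_congr rfl fun x _ => ?_
      rw [Finset.sum_comm]
      refine Finset.sum_congr rfl fun y _ => Finset.sum_congr rfl fun ω _ => ?_
      by_cases h1 : J x ⊆ W' <;> by_cases h2 : J y ⊆ W' <;> by_cases h3 : J x ⊆ ω <;>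
        by_cases h4 : J y ⊆ ω <;> simp [h1, h2, h3, h4, Finset.union_subset_iff]
    rw [hexp]
    refine Finset.sum_le_sum fun x hx => Finset.sum_le_sum fun y hy => ?_
    by_cases h : J x ∪ J y ⊆ W'
    · simp only [h, if_true, one_mul]
      have hC : 0 ≤ C x * C y := mul_nonneg ((abs_nonneg _).trans (hc x hx ∅))
        ((abs_nonneg _).trans (hc y hy ∅))
      calc _ ≤ ∑ ω, C x * C y * (ν ω * if J x ∪ J y ⊆ ω then 1 else 0) := by
            refine Finset.sum_le_sum fun ω _ => ?_
            have h1 : c x (ω ∩ W) * c y (ω ∩ W) ≤ C x * C y := by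
              refine (le_abs_self _).trans ?_
              rw [abs_mul]
              exact mul_le_mul (hc x hx _) (hc y hy _) (abs_nonneg _)
                ((abs_nonneg _).trans (hc x hx ∅))
            split_ifs
            · have := mul_le_mul_of_nonneg_left h1 (hν ω)
              linarith
            · simp
        _ = C x * C y * ∑ ω, (ν ω * if J x ∪ J y ⊆ ω then 1 else 0) := by
            rw [Finset.mul_sum]
        _ ≤ _ := mul_le_mul_of_nonneg_left (hmom _) hC
    · simp [h]

end Gain

section Counting

/-- The probability that a fixed `j`-subset of an `n`-set lies in a uniformly random
`m`-subset. -/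
def inclProb (n m j : ℕ) : ℝ :=
  ∏ i ∈ Finset.range j, ((m : ℝ) - i) / ((n : ℝ) - i)

theorem choose_sub_eq_mul_inclProb {n m j : ℕ} (hj : j ≤ m) (hm : m ≤ n) :
    ((n - j).choose (m - j) : ℝ) = n.choose m * inclProb n m j := by
  induction j with
  | zero => simp [inclProb]
  | succ j ih =>
    have h1 := Nat.add_one_mul_choose_eq (n - (j + 1)) (m - (j + 1))
    rw [show n - (j + 1) + 1 = n - j by omega,
      show m - (j + 1) + 1 = m - j by omega] at h1
    have h2 : ((n : ℝ) - j) * ((n - (j + 1)).choose (m - (j + 1)) : ℝ) =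
        ((n - j).choose (m - j) : ℝ) * ((m : ℝ) - j) := by
      rw [← Nat.cast_sub (by omega), ← Nat.cast_sub (by omega)]
      exact_mod_cast h1
    have h3 : ((n : ℝ) - j) ≠ 0 := by
      rw [← Nat.cast_sub (by omega)]
      exact_mod_cast (by omega : n - j ≠ 0)
    rw [inclProb, Finset.prod_range_succ, ← inclProb, ← mul_assoc, ← ih (by omega),
      mul_div_assoc', eq_div_iff h3, ← h2, mul_comm]

theorem sum_powersetCard_indicator {V : Type*} [DecidableEq V] {U J : Finset V} {m : ℕ}
    (hJ : J ⊆ U) (hj : J.card ≤ m) (hm : m ≤ U.card) :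
    ∑ W ∈ U.powersetCard m, (if J ⊆ W then (1 : ℝ) else 0) =
      U.card.choose m * inclProb U.card m J.card := by
  rw [← choose_sub_eq_mul_inclProb hj hm, Finset.sum_boole]
  congr 1
  convert Finset.card_filter_powersetCard_subset J U m hJ hj

theorem inclProb_succ (n m j : ℕ) :
    inclProb n m (j + 1) = inclProb n m j * (((m : ℝ) - j) / ((n : ℝ) - j)) := by
  rw [inclProb, Finset.prod_range_succ, ← inclProb]

theorem inclProb_nonneg {n m j : ℕ} (hj : j ≤ m) (hm : m ≤ n) : 0 ≤ inclProb n m j :=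
  Finset.prod_nonneg fun i hi => by
    have : (i : ℝ) ≤ m := by exact_mod_cast (Finset.mem_range.1 hi).le.trans hj
    have : (m : ℝ) ≤ n := by exact_mod_cast hm
    exact div_nonneg (by linarith) (by linarith)

theorem inclProb_add_le {n m j k : ℕ} (hjk : j + k ≤ m) (hm : m ≤ n) :
    inclProb n m (j + k) ≤ inclProb n m j * inclProb n m k := by
  induction k with
  | zero => simp [inclProb]
  | succ k ih =>
    rw [← add_assoc, inclProb_succ, inclProb_succ, ← mul_assoc]
    have h1 : ((j : ℝ) + k + 1) ≤ m := by exact_mod_cast hjk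
    have h2 : (m : ℝ) ≤ n := by exact_mod_cast hm
    have h3 : (0 : ℝ) ≤ j := by positivity
    refine mul_le_mul (ih (by omega)) ?_ ?_
      (mul_nonneg (inclProb_nonneg (by omega) hm) (inclProb_nonneg (by omega) hm))
    · push_cast
      rw [div_le_div_iff₀ (by linarith) (by linarith)]
      nlinarith
    · push_cast
      exact div_nonneg (by linarith) (by linarith)

theorem inclProb_mul_pow_le {n m k t : ℕ} {θ : ℝ} (hkt : k + t ≤ m) (hm : m ≤ n) (hθ : 0 ≤ θ)
    (h : ∀ i < k + t, θ ≤ ((m : ℝ) - i) / ((n : ℝ) - i)) :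
    inclProb n m k * θ ^ t ≤ inclProb n m (k + t) := by
  induction t with
  | zero => simp
  | succ t ih =>
    rw [← add_assoc, inclProb_succ, pow_succ, ← mul_assoc]
    exact mul_le_mul (ih (by omega) fun i hi => h i (by omega))
      (by simpa using h (k + t) (by omega)) hθ (inclProb_nonneg (by omega) hm)

theorem half_inclProb_le_sub {n m j : ℕ} (hj : j < m) (hm : 2 * m ≤ n) :
    1 / 2 * inclProb n m j ≤ inclProb n m j - inclProb n m (j + 1) := by
  have h0 : 0 ≤ inclProb n m j := inclProb_nonneg hj.le (by omega)
  have h1 : (j : ℝ) < m := by exact_mod_cast hj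
  have h2 : 2 * (m : ℝ) ≤ n := by exact_mod_cast hm
  have h3 : (0 : ℝ) ≤ j := by positivity
  have h4 : ((m : ℝ) - j) / ((n : ℝ) - j) ≤ 1 / 2 := by
    rw [div_le_div_iff₀ (by linarith) (by norm_num)]
    linarith
  rw [inclProb_succ]
  nlinarith

end Counting

section SecondMoment

variable {V : Type*} [Fintype V] [DecidableEq V]

theorem inclProb_pos {n m j : ℕ} {θ : ℝ} (hj : j ≤ m) (hm : m ≤ n) (hθ : 0 < θ)
    (h : ∀ i < j, θ ≤ ((m : ℝ) - i) / ((n : ℝ) - i)) : 0 < inclProb n m j := by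
  have := inclProb_mul_pow_le (k := 0) (t := j) (by omega) hm hθ.le (by simpa using h)
  rw [zero_add] at this
  refine lt_of_lt_of_le ?_ this
  simp only [inclProb, Finset.range_zero, Finset.prod_empty, one_mul]
  positivity

/-- Averaging over a uniformly random `m`-subset `W'` of `U` the lower bound for the entropy
gain at `b`. -/
theorem sum_powersetCard_gain {ι V : Type*} [DecidableEq V] {U : Finset V} {m : ℕ} (hm : 2 * m ≤ U.card)
    {b : V} (hb : b ∈ U) {a : ℝ} (ha : 0 ≤ a) (I : Finset ι) (J : ι → Finset V)
    (hJU : ∀ x ∈ I, J x ⊆ U) (hbJ : ∀ x ∈ I, b ∉ J x)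
    (hJ : ∀ x ∈ I, ∀ y ∈ I, (J x ∪ J y).card < m)
    (f : ι → ℝ) (hf : ∀ x ∈ I, 0 ≤ f x) (g : ι → ι → ℝ)
    (hg : ∀ x ∈ I, ∀ y ∈ I, 0 ≤ g x y) :
    (U.card.choose m : ℝ) * (a * (∑ x ∈ I, inclProb U.card m (J x).card * f x -
        ∑ x ∈ I, ∑ y ∈ I, inclProb U.card m (J x ∪ J y).card * g x y)) ≤
      ∑ W' ∈ U.powersetCard m, if b ∉ W' then
        a * (2 * ∑ x ∈ I, (if J x ⊆ W' then 1 else 0) * f x -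
          ∑ x ∈ I, ∑ y ∈ I, (if J x ∪ J y ⊆ W' then 1 else 0) * g x y) else 0 := by
  set N : ℝ := (U.card.choose m : ℝ)
  have hN : 0 ≤ N := by positivity
  have hfirst : ∀ K ⊆ U, b ∉ K → K.card < m →
      N * (1 / 2 * inclProb U.card m K.card) ≤ ∑ W' ∈ U.powersetCard m,
        (if b ∉ W' then (1 : ℝ) else 0) * if K ⊆ W' then 1 else 0 := by
    intro K hK hbK hKm
    have h1 := sum_powersetCard_indicator hK hKm.le (by omega)
    have h2 := sum_powersetCard_indicator (J := insert b K) (U := U) (m := m)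
      (Finset.insert_subset hb hK) (by rw [Finset.card_insert_of_notMem hbK]; omega) (by omega)
    rw [Finset.card_insert_of_notMem hbK] at h2
    have h3 : ∑ W' ∈ U.powersetCard m,
        (if b ∉ W' then (1 : ℝ) else 0) * (if K ⊆ W' then 1 else 0) =
        ∑ W' ∈ U.powersetCard m, (if K ⊆ W' then (1 : ℝ) else 0) -
          ∑ W' ∈ U.powersetCard m, if insert b K ⊆ W' then (1 : ℝ) else 0 := by
      rw [← Finset.sum_sub_distrib]
      refine Finset.sum_congr rfl fun W' _ => ?_
      by_cases h : b ∈ W' <;> by_cases h' : K ⊆ W' <;> simp [h, h', Finset.insert_subset_iff]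
    rw [h3, h1, h2, ← mul_sub]
    exact mul_le_mul_of_nonneg_left (half_inclProb_le_sub hKm hm) hN
  have hsecond : ∀ K ⊆ U, K.card < m → ∑ W' ∈ U.powersetCard m,
      ((if b ∉ W' then (1 : ℝ) else 0) * if K ⊆ W' then 1 else 0) ≤
        N * inclProb U.card m K.card := by
    intro K hK hKm
    rw [← sum_powersetCard_indicator hK hKm.le (by omega)]
    refine Finset.sum_le_sum fun W' _ => ?_
    split_ifs <;> simp
  have e : ∑ W' ∈ U.powersetCard m, (if b ∉ W' then
        a * (2 * ∑ x ∈ I, (if J x ⊆ W' then 1 else 0) * f x -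
          ∑ x ∈ I, ∑ y ∈ I, (if J x ∪ J y ⊆ W' then 1 else 0) * g x y) else 0) =
      a * (2 * ∑ x ∈ I, (∑ W' ∈ U.powersetCard m,
          (if b ∉ W' then (1 : ℝ) else 0) * if J x ⊆ W' then 1 else 0) * f x -
        ∑ x ∈ I, ∑ y ∈ I, (∑ W' ∈ U.powersetCard m,
          (if b ∉ W' then (1 : ℝ) else 0) * if J x ∪ J y ⊆ W' then 1 else 0) * g x y) := by
    have s1 : ∑ x ∈ I, (∑ W' ∈ U.powersetCard m,
          (if b ∉ W' then (1 : ℝ) else 0) * if J x ⊆ W' then 1 else 0) * f x =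
        ∑ W' ∈ U.powersetCard m, (if b ∉ W' then (1 : ℝ) else 0) *
          ∑ x ∈ I, (if J x ⊆ W' then 1 else 0) * f x := by
      simp_rw [Finset.sum_mul, Finset.mul_sum]
      rw [Finset.sum_comm]
      simp_rw [mul_assoc]
    have s2 : ∑ x ∈ I, ∑ y ∈ I, (∑ W' ∈ U.powersetCard m,
          (if b ∉ W' then (1 : ℝ) else 0) * if J x ∪ J y ⊆ W' then 1 else 0) * g x y =
        ∑ W' ∈ U.powersetCard m, (if b ∉ W' then (1 : ℝ) else 0) *
          ∑ x ∈ I, ∑ y ∈ I, (if J x ∪ J y ⊆ W' then 1 else 0) * g x y := by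
      simp_rw [Finset.sum_mul, Finset.mul_sum]
      symm
      rw [Finset.sum_comm]
      refine Finset.sum_congr rfl fun x _ => ?_
      rw [Finset.sum_comm]
      simp_rw [mul_assoc]
    rw [s1, s2, Finset.mul_sum, ← Finset.sum_sub_distrib, Finset.mul_sum]
    refine Finset.sum_congr rfl fun W' _ => ?_
    split_ifs <;> ring
  rw [e, mul_left_comm]
  refine mul_le_mul_of_nonneg_left ?_ ha
  rw [mul_sub, Finset.mul_sum, Finset.mul_sum, Finset.mul_sum]
  refine sub_le_sub (Finset.sum_le_sum fun x hx => ?_) (Finset.sum_le_sum fun x hx => ?_)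
  · have := mul_le_mul_of_nonneg_right (hfirst (J x) (hJU x hx) (hbJ x hx)
      (by simpa using hJ x hx x hx)) (hf x hx)
    linarith
  · rw [Finset.mul_sum]
    refine Finset.sum_le_sum fun y hy => ?_
    have := mul_le_mul_of_nonneg_right (hsecond (J x ∪ J y)
      (Finset.union_subset (hJU x hx) (hJU y hy)) (hJ x hx y hy)) (hg x hx y hy)
    linarith

/-- The pairs `(A, B)` with `A` an edge of `H − W` and `B ⊆ A` a set of size at least two
containing `b`. -/
def edgePairs (H : Finset (Finset V)) (W : Finset V) (b : V) :
    Finset (Finset V × Finset V) :=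
  (H.filter (fun A => Disjoint A W) ×ˢ Finset.univ).filter
    (fun x => x.2 ⊆ x.1 ∧ 2 ≤ x.2.card ∧ b ∈ x.2)

theorem mem_edgePairs {H : Finset (Finset V)} {W : Finset V} {b : V}
    {x : Finset V × Finset V} : x ∈ edgePairs H W b ↔
      (x.1 ∈ H ∧ Disjoint x.1 W) ∧ x.2 ⊆ x.1 ∧ 2 ≤ x.2.card ∧ b ∈ x.2 := by
  simp [edgePairs]

/-- The weight `1 / (C(r, j) · j)`. -/
def pairWeight (r j : ℕ) : ℝ := ((r.choose j : ℝ) * j)⁻¹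

theorem pairWeight_nonneg (r j : ℕ) : 0 ≤ pairWeight r j := by
  unfold pairWeight; positivity

theorem sum_pairWeight {V : Type*} [DecidableEq V] (A : Finset V) {b : V} (hb : b ∈ A) :
    ∑ B ∈ A.powerset, (if b ∈ B then pairWeight A.card B.card else 0) = 1 := by
  have h := Finset.sum_powerset_insert (Finset.notMem_erase b A)
    (fun B => if b ∈ B then pairWeight A.card B.card else 0)
  rw [Finset.insert_erase hb] at h
  have hnot : ∀ T ∈ (A.erase b).powerset, b ∉ T := fun T hT hbT => by
    simpa using Finset.mem_powerset.1 hT hbT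
  have hA : (A.erase b).card + 1 = A.card := Finset.card_erase_add_one hb
  have h1 : ∑ T ∈ (A.erase b).powerset, (if b ∈ T then pairWeight A.card T.card else 0) = 0 :=
    Finset.sum_eq_zero fun T hT => by simp [hnot T hT]
  have h2 : ∑ T ∈ (A.erase b).powerset,
      (if b ∈ insert b T then pairWeight A.card (insert b T).card else 0) =
      ∑ T ∈ (A.erase b).powerset, pairWeight A.card (T.card + 1) :=
    Finset.sum_congr rfl fun T hT => by
      rw [if_pos (Finset.mem_insert_self _ _), Finset.card_insert_of_notMem (hnot T hT)]
  rw [h, h1, h2, zero_add,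
    Finset.sum_powerset_apply_card (fun j => pairWeight A.card (j + 1)), ← hA]
  generalize (A.erase b).card = k
  have h3 : ∀ j ∈ Finset.range (k + 1),
      k.choose j • pairWeight (k + 1) (j + 1) = ((k + 1 : ℕ) : ℝ)⁻¹ := by
    intro j hj
    have h4 : (((k + 1).choose (j + 1) : ℕ) : ℝ) * ((j + 1 : ℕ) : ℝ) =
        ((k + 1 : ℕ) : ℝ) * (k.choose j : ℝ) := by
      exact_mod_cast (Nat.add_one_mul_choose_eq k j).symm
    have h5 : (k.choose j : ℝ) ≠ 0 := by
      exact_mod_cast (Nat.choose_pos (Nat.lt_succ_iff.1 (Finset.mem_range.1 hj))).ne'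
    rw [pairWeight, h4, nsmul_eq_mul, mul_inv]
    field_simp
  rw [Finset.sum_congr rfl h3, Finset.sum_const, Finset.card_range, nsmul_eq_mul]
  exact mul_inv_cancel₀ (by positivity)

theorem sum_edgePairs_le_degH {r : ℕ} {H : Finset (Finset V)} {d : Finset V → ℝ}
    (hunif : ∀ A ∈ H, A.card = r) (hd : ∀ A ∈ H, 0 < d A) (W : Finset V) (b : V)
    (T : Finset V) :
    ∑ x ∈ edgePairs H W b, (if T ⊆ x.2 then d x.1 * pairWeight r x.2.card else 0) ≤
      degH H d (insert b T) := by
  unfold edgePairs degH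
  rw [Finset.sum_filter, Finset.sum_product, Finset.sum_filter]
  refine Finset.sum_le_sum fun A hA => ?_
  have hdA := (hd A hA).le
  have hnn : (0 : ℝ) ≤ if insert b T ⊆ A then d A else 0 := by split_ifs <;> simp [hdA]
  split_ifs with h1 h2
  · have hb : b ∈ A := h2 (Finset.mem_insert_self _ _)
    calc _ ≤ ∑ B : Finset V, d A *
          (if B ⊆ A then (if b ∈ B then pairWeight A.card B.card else 0) else 0) := by
          refine Finset.sum_le_sum fun B _ => ?_
          rw [hunif A hA]
          have := mul_nonneg hdA (pairWeight_nonneg r B.card)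
          by_cases c1 : B ⊆ A <;> by_cases c2 : 2 ≤ B.card <;> by_cases c3 : b ∈ B <;>
            by_cases c4 : T ⊆ B <;> simp [c1, c2, c3, c4, this]
      _ = d A := by
          rw [← Finset.mul_sum, ← Finset.sum_filter]
          have : Finset.univ.filter (fun B => B ⊆ A) = A.powerset := by ext; simp
          rw [this, sum_pairWeight A hb, mul_one]
  · refine Finset.sum_nonpos fun B _ => ?_
    split_ifs with c1 c2
    · exact absurd (Finset.insert_subset (c1.1 c1.2.2) (c2.trans c1.1)) h2
    · rfl
    · rfl
  · exact hdA
  · rfl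

theorem sum_sum_edgePairs_le {r : ℕ} {H : Finset (Finset V)} {d : Finset V → ℝ}
    (hunif : ∀ A ∈ H, A.card = r) (hd : ∀ A ∈ H, 0 < d A) (W S : Finset V) :
    ∑ b ∈ S, ∑ x ∈ edgePairs H W b, d x.1 * pairWeight r x.2.card ≤ r * eTot H d := by
  calc _ ≤ ∑ b ∈ S, degH H d {b} := Finset.sum_le_sum fun b _ => by
        simpa using sum_edgePairs_le_degH hunif hd W b ∅
    _ ≤ ∑ b, degH H d {b} := Finset.sum_le_sum_of_subset_of_nonneg (Finset.subset_univ _)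
        fun b _ _ => Finset.sum_nonneg fun A hA => by split_ifs <;> simp [(hd A hA).le]
    _ = r * eTot H d := by
        unfold degH eTot
        rw [Finset.sum_comm, Finset.mul_sum]
        refine Finset.sum_congr rfl fun A hA => ?_
        simp [Finset.singleton_subset_iff, hunif A hA]

theorem sum_powerset_inv_pow_le {V : Type*} {r : ℕ} (hr : 1 ≤ r) (J : Finset V) (hJ : J.card ≤ r) :
    ∑ T ∈ J.powerset, ((r : ℝ)⁻¹) ^ T.card ≤ 3 := by
  have h := Finset.sum_pow_mul_eq_add_pow ((r : ℝ)⁻¹) 1 J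
  simp only [one_pow, mul_one] at h
  rw [h]
  have hr0 : (0 : ℝ) < r := by exact_mod_cast hr
  calc ((r : ℝ)⁻¹ + 1) ^ J.card ≤ ((r : ℝ)⁻¹ + 1) ^ r :=
        pow_le_pow_right₀ (by simp) hJ
    _ ≤ Real.exp ((r : ℝ)⁻¹) ^ r := by
        gcongr
        exact Real.add_one_le_exp _
    _ = Real.exp 1 := by rw [← Real.exp_nat_mul, mul_inv_cancel₀ hr0.ne']
    _ ≤ 3 := by linarith [Real.exp_one_lt_d9]

theorem inclProb_ratio_le {n m r j k u t : ℕ} {p θ : ℝ} (hp : 0 < p) (hθ : 0 < θ)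
    (hm : m ≤ n) (hr : 2 * r ≤ m) (hj : j < r) (hk : k < r) (ht : t ≤ k)
    (hu : u + t = j + k) (h : ∀ i < r, θ ≤ ((m : ℝ) - i) / ((n : ℝ) - i)) :
    (p ^ (j + 1))⁻¹ * (inclProb n m j)⁻¹ * ((p ^ (k + 1))⁻¹ * (inclProb n m k)⁻¹) *
      (inclProb n m u * p ^ u) ≤ (p ^ 2)⁻¹ * ((p * θ) ^ t)⁻¹ := by
  have h1 : 0 < inclProb n m j :=
    inclProb_pos (by omega) hm hθ fun i hi => h i (by omega)
  have h2 : 0 < inclProb n m k :=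
    inclProb_pos (by omega) hm hθ fun i hi => h i (by omega)
  have h3 := inclProb_mul_pow_le (k := k - t) (t := t) (by omega) hm hθ.le
    fun i hi => h i (by omega)
  rw [Nat.sub_add_cancel ht] at h3
  have h4 := inclProb_add_le (j := j) (k := k - t) (by omega) hm
  rw [show j + (k - t) = u by omega] at h4
  have h5 : inclProb n m u * θ ^ t ≤ inclProb n m j * inclProb n m k := by
    calc _ ≤ inclProb n m j * inclProb n m (k - t) * θ ^ t := by gcongr
      _ = inclProb n m j * (inclProb n m (k - t) * θ ^ t) := by ring
      _ ≤ _ := by gcongr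
  have e1 : p ^ (j + 1) * p ^ (k + 1) = p ^ u * (p ^ 2 * p ^ t) := by
    rw [← pow_add, ← pow_add, ← pow_add]; congr 1; omega
  have e2 : (p ^ (j + 1))⁻¹ * (inclProb n m j)⁻¹ * ((p ^ (k + 1))⁻¹ * (inclProb n m k)⁻¹) *
      (inclProb n m u * p ^ u) =
      (p ^ 2)⁻¹ * (p ^ t)⁻¹ * (inclProb n m u / (inclProb n m j * inclProb n m k)) := by
    have : (p ^ (j + 1))⁻¹ * (p ^ (k + 1))⁻¹ * p ^ u = (p ^ 2)⁻¹ * (p ^ t)⁻¹ := by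
      rw [← mul_inv, e1]; field_simp
    rw [← this]
    field_simp
  rw [e2, mul_pow, mul_inv, ← mul_assoc]
  refine mul_le_mul_of_nonneg_left ?_ (by positivity)
  rw [div_le_iff₀ (by positivity), inv_mul_eq_div, le_div_iff₀ (by positivity)]
  exact h5

theorem second_moment_le {r n m : ℕ} (hr1 : 1 ≤ r) {H : Finset (Finset V)}
    {d : Finset V → ℝ} (hunif : ∀ A ∈ H, A.card = r) (hd : ∀ A ∈ H, 0 < d A)
    {p θ D : ℝ} (hp : 0 < p) (hθ : 0 < θ) (hD : 0 ≤ D) (hm : m ≤ n) (hr : 2 * r ≤ m)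
    (h : ∀ i < r, θ ≤ ((m : ℝ) - i) / ((n : ℝ) - i))
    (hdeg : ∀ s : ℕ, 1 ≤ s → s ≤ r → ∀ B : Finset V, B.card = s →
      degH H d B ≤ D * (θ / r * p) ^ (s - 1)) (W : Finset V) (b : V) (t : ℝ) :
    ∑ x ∈ edgePairs H W b, ∑ y ∈ edgePairs H W b,
      inclProb n m (x.2.erase b ∪ y.2.erase b).card *
        (t * (d x.1 * pairWeight r x.2.card) * ((p ^ x.2.card)⁻¹ *
            (inclProb n m (x.2.erase b).card)⁻¹) *
          (t * (d y.1 * pairWeight r y.2.card) * ((p ^ y.2.card)⁻¹ *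
            (inclProb n m (y.2.erase b).card)⁻¹)) *
          p ^ (x.2.erase b ∪ y.2.erase b).card) ≤
      t ^ 2 * (p ^ 2)⁻¹ * (3 * D) *
        ∑ x ∈ edgePairs H W b, d x.1 * pairWeight r x.2.card := by
  have hdw : ∀ x ∈ edgePairs H W b, 0 ≤ d x.1 * pairWeight r x.2.card := fun x hx =>
    mul_nonneg (hd _ (mem_edgePairs.1 hx).1.1).le (pairWeight_nonneg _ _)
  have hcard : ∀ x ∈ edgePairs H W b,
      (x.2.erase b).card + 1 = x.2.card ∧ (x.2.erase b).card < r := fun x hx => by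
    obtain ⟨⟨h1, -⟩, h2, -, h4⟩ := mem_edgePairs.1 hx
    have := Finset.card_erase_add_one h4
    have := Finset.card_le_card h2
    have := hunif _ h1
    omega
  have hr0 : (0 : ℝ) < r := by exact_mod_cast hr1
  have hinner : ∀ x ∈ edgePairs H W b, ∑ y ∈ edgePairs H W b,
      (d y.1 * pairWeight r y.2.card) *
        ((p * θ) ^ (x.2.erase b ∩ y.2.erase b).card)⁻¹ ≤ 3 * D := by
    intro x hx
    calc _ ≤ ∑ y ∈ edgePairs H W b, ∑ T ∈ (x.2.erase b).powerset,
          ((p * θ) ^ T.card)⁻¹ *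
            (if T ⊆ y.2 then d y.1 * pairWeight r y.2.card else 0) := by
          refine Finset.sum_le_sum fun y hy => ?_
          have hs : x.2.erase b ∩ y.2.erase b ∈ (x.2.erase b).powerset :=
            Finset.mem_powerset.2 Finset.inter_subset_left
          refine le_trans (le_of_eq ?_) (Finset.single_le_sum (f := fun T =>
            ((p * θ) ^ T.card)⁻¹ * (if T ⊆ y.2 then d y.1 * pairWeight r y.2.card else 0))
            (fun T _ => mul_nonneg (by positivity) ?_) hs)
          · rw [if_pos (Finset.inter_subset_right.trans (Finset.erase_subset _ _)), mul_comm]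
          · split_ifs
            · exact hdw y hy
            · rfl
      _ = ∑ T ∈ (x.2.erase b).powerset, ((p * θ) ^ T.card)⁻¹ *
            ∑ y ∈ edgePairs H W b,
              if T ⊆ y.2 then d y.1 * pairWeight r y.2.card else 0 := by
          rw [Finset.sum_comm]
          simp_rw [Finset.mul_sum]
      _ ≤ ∑ T ∈ (x.2.erase b).powerset, D * ((r : ℝ)⁻¹) ^ T.card := by
          refine Finset.sum_le_sum fun T hT => ?_
          have hT' := Finset.mem_powerset.1 hT
          have hbT : b ∉ T := fun hb => by simpa using hT' hb
          have hTc := Finset.card_le_card hT'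
          have h1 := sum_edgePairs_le_degH hunif hd W b T
          have h2 := hdeg (T.card + 1) (by omega) (by have := (hcard x hx).2; omega)
            (insert b T) (Finset.card_insert_of_notMem hbT)
          calc _ ≤ ((p * θ) ^ T.card)⁻¹ * (D * (θ / r * p) ^ T.card) :=
                mul_le_mul_of_nonneg_left (h1.trans h2) (by positivity)
            _ = _ := by
                rw [show θ / r * p = (p * θ) * (r : ℝ)⁻¹ by ring, mul_pow (p * θ)]
                field_simp
      _ ≤ 3 * D := by
          rw [← Finset.mul_sum, mul_comm 3]
          exact mul_le_mul_of_nonneg_left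
            (sum_powerset_inv_pow_le hr1 _ (hcard x hx).2.le) hD
  calc _ ≤ ∑ x ∈ edgePairs H W b, ∑ y ∈ edgePairs H W b,
        t ^ 2 * (p ^ 2)⁻¹ * (d x.1 * pairWeight r x.2.card) *
          ((d y.1 * pairWeight r y.2.card) *
            ((p * θ) ^ (x.2.erase b ∩ y.2.erase b).card)⁻¹) := by
        refine Finset.sum_le_sum fun x hx => Finset.sum_le_sum fun y hy => ?_
        have hratio := inclProb_ratio_le hp hθ hm hr (hcard x hx).2 (hcard y hy).2
          (Finset.card_le_card Finset.inter_subset_right)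
          (Finset.card_union_add_card_inter (x.2.erase b) (y.2.erase b)) h
        rw [(hcard x hx).1, (hcard y hy).1] at hratio
        have := mul_le_mul_of_nonneg_left hratio (mul_nonneg (mul_nonneg (sq_nonneg t)
          (hdw x hx)) (hdw y hy))
        convert this using 1 <;> ring
    _ = ∑ x ∈ edgePairs H W b, t ^ 2 * (p ^ 2)⁻¹ * (d x.1 * pairWeight r x.2.card) *
          ∑ y ∈ edgePairs H W b, (d y.1 * pairWeight r y.2.card) *
            ((p * θ) ^ (x.2.erase b ∩ y.2.erase b).card)⁻¹ := by
        simp_rw [Finset.mul_sum]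
    _ ≤ ∑ x ∈ edgePairs H W b, t ^ 2 * (p ^ 2)⁻¹ * (d x.1 * pairWeight r x.2.card) *
          (3 * D) :=
        Finset.sum_le_sum fun x hx => mul_le_mul_of_nonneg_left (hinner x hx)
          (mul_nonneg (by positivity) (hdw x hx))
    _ = _ := by
        rw [Finset.mul_sum]
        exact Finset.sum_congr rfl fun x _ => by ring

end SecondMoment

section LowerTail

variable {V : Type*} [Fintype V] [DecidableEq V] {H : Finset (Finset V)}
  {d : Finset V → ℝ} {r : ℕ} {p η : ℝ}

/-- The law of the `p`-random subset of `V` conditioned on the lower-tail event. -/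
def lowerTailWeight (H : Finset (Finset V)) (d : Finset V → ℝ) (r : ℕ) (p η : ℝ)
    (ω : Finset V) : ℝ :=
  (if eInd H d ω ≤ η * p ^ r * eTot H d then pw (fun _ => p) ω else 0) /
    ∑ ω : Finset V, if eInd H d ω ≤ η * p ^ r * eTot H d then pw (fun _ => p) ω else 0

theorem pw_nonneg (hp : 0 ≤ p) (hp1 : p ≤ 1) (ω : Finset V) : 0 ≤ pw (fun _ => p) ω :=
  mul_nonneg (Finset.prod_nonneg fun _ _ => hp) (Finset.prod_nonneg fun _ _ => by linarith)

theorem pw_insert {ω : Finset V} {b : V} (hb : b ∉ ω) :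
    (1 - p) * pw (fun _ => p) (insert b ω) = p * pw (fun _ => p) ω := by
  have h : ωᶜ = insert b (insert b ω)ᶜ := by
    ext x
    by_cases hx : x = b <;> simp [hx, hb]
  unfold pw
  rw [h, Finset.prod_insert hb, Finset.prod_insert (by simp)]
  ring

theorem eInd_mono {V : Type*} [DecidableEq V] {H : Finset (Finset V)} {d : Finset V → ℝ}
    (hd : ∀ A ∈ H, 0 < d A) {ω ω' : Finset V} (h : ω ⊆ ω') :
    eInd H d ω ≤ eInd H d ω' := by
  refine Finset.sum_le_sum fun A hA => ?_
  have := (hd A hA).le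
  split_ifs with h1 h2
  · rfl
  · exact absurd (h1.trans h) h2
  · exact this
  · rfl

theorem lowerTailWeight_nonneg (hp : 0 ≤ p) (hp1 : p ≤ 1)
    (ω : Finset V) : 0 ≤ lowerTailWeight H d r p η ω := by
  refine div_nonneg ?_ (Finset.sum_nonneg fun ω _ => ?_) <;>
    split_ifs <;> simp [pw_nonneg hp hp1]

theorem sum_lowerTailWeight (hpos : ∀ A ∈ H, 0 < A.card) (hd : ∀ A ∈ H, 0 < d A)
    (hp : 0 ≤ p) (hp1 : p < 1) (hη : 0 ≤ η) : ∑ ω, lowerTailWeight H d r p η ω = 1 := by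
  unfold lowerTailWeight
  rw [← Finset.sum_div]
  refine div_self (Finset.sum_pos' (fun ω _ => ?_) ⟨∅, Finset.mem_univ _, ?_⟩).ne'
  · split_ifs <;> simp [pw_nonneg hp hp1.le]
  · have h1 : eInd H d ∅ = 0 := Finset.sum_eq_zero fun A hA => by
      rw [if_neg]
      intro h
      have := hpos A hA
      simp [Finset.subset_empty.1 h] at this
    have h2 : 0 ≤ eTot H d := Finset.sum_nonneg fun A hA => (hd A hA).le
    rw [if_pos (by rw [h1]; positivity)]
    simp only [pw, Finset.prod_empty, one_mul]
    exact Finset.prod_pos fun _ _ => by linarith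

theorem lowerTailWeight_insert_le (hd : ∀ A ∈ H, 0 < d A) (hp : 0 ≤ p) (hp1 : p ≤ 1)
    (ω : Finset V) (b : V) (hb : b ∉ ω) :
    (1 - p) * lowerTailWeight H d r p η (insert b ω) ≤ p * lowerTailWeight H d r p η ω := by
  unfold lowerTailWeight
  rw [← mul_div_assoc, ← mul_div_assoc]
  refine div_le_div_of_nonneg_right ?_
    (Finset.sum_nonneg fun ω _ => by split_ifs <;> simp [pw_nonneg hp hp1])
  have h1 := eInd_mono hd (Finset.subset_insert b ω)
  have h2 := pw_nonneg hp hp1 ω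
  split_ifs with h3 h4
  · exact (pw_insert hb).le
  · exact absurd (h1.trans h3) h4
  · simpa using mul_nonneg hp h2
  · simp

theorem nuPr_eq (P : Finset V → Prop) [DecidablePred P] : nuPr H d r p η P =
    ∑ ω, if P ω then lowerTailWeight H d r p η ω else 0 := by
  unfold nuPr lowerTailWeight
  rw [Finset.sum_div]
  refine Finset.sum_congr rfl fun ω _ => ?_
  by_cases h : P ω <;> simp [h]

theorem condE_eq (W s B : Finset V) :
    condE H d r p η W s B = cexp (lowerTailWeight H d r p η) W s B := by
  unfold condE cexp
  rw [nuPr_eq, nuPr_eq]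

theorem HW_eq (W : Finset V) : HW H d r p η W = ∑ b ∈ Wᶜ, ∑ ω,
    lowerTailWeight H d r p η ω *
      ip p (cexp (lowerTailWeight H d r p η) W (ω ∩ W) {b}) := by
  unfold HW
  refine Finset.sum_congr rfl fun b _ => ?_
  simp_rw [nuPr_eq, condE_eq]
  exact sum_powerset_fiber_mul _ W
    (fun s => ip p (cexp (lowerTailWeight H d r p η) W s {b}))

theorem errW_eq (W : Finset V) : errW H d r p η W = ∑ b ∈ Wᶜ, ∑ x ∈ edgePairs H W b,
    d x.1 * pairWeight r x.2.card * ((p ^ x.2.card)⁻¹) ^ 2 * ∑ ω,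
      lowerTailWeight H d r p η ω * (cexp (lowerTailWeight H d r p η) W (ω ∩ W) x.2 -
        cexp (lowerTailWeight H d r p η) W (ω ∩ W) (x.2.erase b) *
          cexp (lowerTailWeight H d r p η) W (ω ∩ W) {b}) ^ 2 := by
  have key : ∀ s, ∑ A ∈ H.filter (fun A => Disjoint A W),
      ∑ B ∈ A.powerset.filter (fun B => 2 ≤ B.card), ∑ b ∈ B,
        d A * (DW H d r p η W s B b) ^ 2 /
          ((r.choose B.card : ℝ) * (B.card : ℝ) * p ^ (2 * B.card)) =
      ∑ b ∈ Wᶜ, ∑ x ∈ edgePairs H W b,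
        d x.1 * pairWeight r x.2.card * ((p ^ x.2.card)⁻¹) ^ 2 *
          DW H d r p η W s x.2 b ^ 2 := by
    intro s
    unfold edgePairs
    simp_rw [Finset.sum_filter _ (fun x : Finset V × Finset V => _), Finset.sum_product]
    rw [Finset.sum_comm]
    refine Finset.sum_congr rfl fun A hA => ?_
    rw [Finset.sum_comm, Finset.sum_filter]
    have hpw : A.powerset = Finset.univ.filter (fun B => B ⊆ A) := by ext; simp
    rw [hpw, Finset.sum_filter]
    refine Finset.sum_congr rfl fun B _ => ?_
    by_cases h1 : B ⊆ A
    · by_cases h2 : 2 ≤ B.card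
      · simp only [h1, h2, if_true, true_and]
        rw [← Finset.sum_filter]
        have hB : Wᶜ.filter (fun b => b ∈ B) = B := by
          ext x
          simp only [Finset.mem_filter, Finset.mem_compl, and_iff_right_iff_imp]
          exact fun hx => Finset.disjoint_left.1 (Finset.mem_filter.1 hA).2 (h1 hx)
        rw [hB]
        refine Finset.sum_congr rfl fun b _ => ?_
        rw [pairWeight, div_eq_mul_inv, mul_inv, inv_pow, ← pow_mul, mul_comm B.card 2]
        ring
      · simp [h2]
    · simp [h1]
  unfold errW
  simp_rw [nuPr_eq]
  rw [sum_powerset_fiber_mul _ W (fun s => ∑ A ∈ H.filter (fun A => Disjoint A W),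
      ∑ B ∈ A.powerset.filter (fun B => 2 ≤ B.card), ∑ b ∈ B,
        d A * (DW H d r p η W s B b) ^ 2 /
          ((r.choose B.card : ℝ) * (B.card : ℝ) * p ^ (2 * B.card)))]
  simp_rw [key, Finset.mul_sum]
  rw [Finset.sum_comm]
  refine Finset.sum_congr rfl fun b _ => ?_
  rw [Finset.sum_comm]
  refine Finset.sum_congr rfl fun x _ => Finset.sum_congr rfl fun ω _ => ?_
  simp only [DW, condE_eq]
  ring

end LowerTail

/-- Claim `clm:WWprime`: with the constants `γ = β²/(300Kr)`, `τ = αγ(1−p₀)`,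
`λ = τ/(2r)` and `V₀ = 8r²/τ`, if `(H, d)` is an `r`-uniform weighted hypergraph
satisfying `Δ_s(H) ≤ K (λp)^{s−1} e(H)/v(H)` for all `s ∈ {1,…,r}` (with `p ∈ (0, p₀]`),
`Y` is the indicator vector of the `p`-random subset conditioned on the lower-tail event
`e(H[R]) ≤ η p^r e(H)`, and `W ⊆ V` satisfies `𝓔(W) > β e(H)` and `|V ∖ W| ≥ V₀/2`, then
there exists `W' ⊆ V ∖ W` with `|W'| ≤ τ|V|` and `H(W ∪ W') ≥ H(W) + γ p |V|`. -/
theorem entropy_increment (r : ℕ) (hr : 1 ≤ r) (α β K p₀ γ τ lam V₀ : ℝ)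
    (hα0 : 0 < α) (hα : α < 1 / 2) (hβ0 : 0 < β) (hβ : β < 1) (hK : 1 < K)
    (hp₀ : p₀ < 1)
    (hγ : γ = β ^ 2 / (300 * K * r)) (hτ : τ = α * γ * (1 - p₀))
    (hlam : lam = τ / (2 * r)) (hV₀ : V₀ = 8 * (r : ℝ) ^ 2 / τ)
    {V : Type*} [Fintype V] [DecidableEq V]
    (H : Finset (Finset V)) (d : Finset V → ℝ)
    (hunif : ∀ A ∈ H, A.card = r) (hd : ∀ A ∈ H, 0 < d A)
    (p η : ℝ) (hp0 : 0 < p) (hpp₀ : p ≤ p₀) (hη : 0 ≤ η)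
    (hΔ : ∀ s : ℕ, 1 ≤ s → s ≤ r → ∀ B : Finset V, B.card = s →
      degH H d B ≤ K * (lam * p) ^ (s - 1) * (eTot H d / (Fintype.card V : ℝ)))
    (W : Finset V) (hEW : β * eTot H d < errW H d r p η W)
    (hVW : V₀ / 2 ≤ (Wᶜ.card : ℝ)) :
    ∃ W' : Finset V, W' ⊆ Wᶜ ∧ (W'.card : ℝ) ≤ τ * (Fintype.card V : ℝ) ∧
      HW H d r p η W + γ * p * (Fintype.card V : ℝ) ≤ HW H d r p η (W ∪ W') := by
  have hr1 : (1 : ℝ) ≤ r := by exact_mod_cast hr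
  have hγ0 : 0 < γ := by rw [hγ]; positivity
  have hp1 : p < 1 := by linarith
  have hτ0 : 0 < τ := by rw [hτ]; exact mul_pos (mul_pos hα0 hγ0) (by linarith)
  have hγ1 : γ ≤ 1 := by
    rw [hγ, div_le_one (by positivity)]
    nlinarith [mul_le_mul hK.le hr1 zero_le_one (by linarith)]
  have hτ1 : τ ≤ 1 / 2 := by
    rw [hτ]
    nlinarith [mul_le_mul hα.le hγ1 hγ0.le (by norm_num), mul_pos hα0 hγ0]
  have he : 0 < eTot H d := by
    refine Finset.sum_pos hd (Finset.nonempty_iff_ne_empty.2 fun h => ?_)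
    subst h
    simp [errW, eTot] at hEW
  set n := Wᶜ.card with hn
  set v : ℝ := (Fintype.card V : ℝ) with hv
  have hnv : (n : ℝ) ≤ v := Nat.cast_le.2 (Finset.card_le_univ Wᶜ)
  have hτn : 4 * (r : ℝ) ^ 2 ≤ τ * n := by
    rw [hV₀, div_div, div_le_iff₀ (by positivity)] at hVW
    linarith
  have hn0 : (0 : ℝ) < n := by
    by_contra hcon
    nlinarith
  have hv0 : 0 < v := by linarith
  set m := ⌊τ * n⌋₊ with hm
  have hmle : (m : ℝ) ≤ τ * n := Nat.floor_le (by positivity)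
  have hmge : τ * n < m + 1 := Nat.lt_floor_add_one _
  have h2m : 2 * m ≤ n := by
    have : 2 * (m : ℝ) ≤ n := by nlinarith
    exact_mod_cast this
  have h2r : 2 * r ≤ m := by
    have : (2 * r : ℝ) < m + 1 := by nlinarith
    exact_mod_cast Nat.lt_succ_iff.1 (by exact_mod_cast this)
  have hmn : m ≤ n := by omega
  have hθ : ∀ i < r, τ / 2 ≤ ((m : ℝ) - i) / ((n : ℝ) - i) := by
    intro i hi
    have h1 : (i : ℝ) + 1 ≤ r := by exact_mod_cast hi
    have h2 : (m : ℝ) ≤ n := by exact_mod_cast hmn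
    have h3 : (2 * r : ℝ) ≤ m := by exact_mod_cast h2r
    have h4 : (0 : ℝ) ≤ i := by positivity
    rw [le_div_iff₀ (by linarith)]
    nlinarith
  set ν := lowerTailWeight H d r p η with hνdef
  have hν : ∀ ω, 0 ≤ ν ω := lowerTailWeight_nonneg hp0.le hp1.le
  have hν1 : ∑ ω, ν ω = 1 :=
    sum_lowerTailWeight (fun A hA => by rw [hunif A hA]; omega) hd hp0.le hp1 hη
  have hdown : ∀ ω b, b ∉ ω → (1 - p) * ν (insert b ω) ≤ p * ν ω :=
    lowerTailWeight_insert_le hd hp0.le hp1.le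
  set D : ℝ := K * (eTot H d / v) with hD
  set t : ℝ := β * p ^ 2 * v / (6 * K * eTot H d * r) with ht
  set cov : V → Finset V × Finset V → Finset V → ℝ := fun b x s =>
    cexp ν W s x.2 - cexp ν W s (x.2.erase b) * cexp ν W s {b} with hcov
  set c : V → Finset V × Finset V → Finset V → ℝ := fun b x s =>
    t * (d x.1 * pairWeight r x.2.card) * (((p ^ x.2.card)⁻¹) ^ 2 *
      (inclProb n m (x.2.erase b).card)⁻¹) * cov b x s with hc
  set C : V → Finset V × Finset V → ℝ := fun b x =>
    t * (d x.1 * pairWeight r x.2.card) * ((p ^ x.2.card)⁻¹ *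
      (inclProb n m (x.2.erase b).card)⁻¹) with hC
  set f : V → Finset V × Finset V → ℝ := fun b x => ∑ ω, ν ω * (c b x (ω ∩ W) *
    (cexp ν W (ω ∩ W) (insert b (x.2.erase b)) -
      cexp ν W (ω ∩ W) (x.2.erase b) * cexp ν W (ω ∩ W) {b})) with hf
  set g : V → Finset V × Finset V → Finset V × Finset V → ℝ := fun b x y =>
    C b x * C b y * p ^ (x.2.erase b ∪ y.2.erase b).card with hg
  have ht0 : 0 < t := by positivity
  have hdw : ∀ b, ∀ x ∈ edgePairs H W b, 0 ≤ d x.1 * pairWeight r x.2.card := fun b x hx =>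
    mul_nonneg (hd _ (mem_edgePairs.1 hx).1.1).le (pairWeight_nonneg _ _)
  have hcard : ∀ b, ∀ x ∈ edgePairs H W b, (x.2.erase b).card < r := fun b x hx => by
    obtain ⟨⟨h1, -⟩, h2, -, h4⟩ := mem_edgePairs.1 hx
    have := Finset.card_erase_add_one h4
    have := Finset.card_le_card h2
    have := hunif _ h1
    omega
  have hρ : ∀ b, ∀ x ∈ edgePairs H W b, 0 < inclProb n m (x.2.erase b).card :=
    fun b x hx => inclProb_pos (by have := hcard b x hx; omega) hmn (half_pos hτ0)
      fun i hi => hθ i (hi.trans (hcard b x hx))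
  have hdisj : ∀ b, ∀ x ∈ edgePairs H W b, Disjoint x.2 W := fun b x hx =>
    (mem_edgePairs.1 hx).1.2.mono_left (mem_edgePairs.1 hx).2.1
  have hC0 : ∀ b, ∀ x ∈ edgePairs H W b, 0 ≤ C b x := fun b x hx =>
    mul_nonneg (mul_nonneg ht0.le (hdw b x hx))
      (mul_nonneg (by positivity) (inv_nonneg.2 (hρ b x hx).le))
  have hcC : ∀ b, ∀ x ∈ edgePairs H W b, ∀ s, |c b x s| ≤ C b x := by
    intro b x hx s
    have h1 := abs_cexp_sub_le ν hdown hν hp0.le W s x.2 (hdisj b x hx)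
      (mem_edgePairs.1 hx).2.2.2
    have h2 : 0 ≤ t * (d x.1 * pairWeight r x.2.card) * (((p ^ x.2.card)⁻¹) ^ 2 *
      (inclProb n m (x.2.erase b).card)⁻¹) := mul_nonneg (mul_nonneg ht0.le (hdw b x hx))
        (mul_nonneg (by positivity) (inv_nonneg.2 (hρ b x hx).le))
    simp only [hc, hC, abs_mul]
    rw [← abs_mul, ← abs_mul, ← abs_mul, ← abs_mul, abs_of_nonneg h2]
    refine (mul_le_mul_of_nonneg_left h1 h2).trans (le_of_eq ?_)
    field_simp
  have hfeq : ∀ b, ∀ x ∈ edgePairs H W b, inclProb n m (x.2.erase b).card * f b x =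
      t * (d x.1 * pairWeight r x.2.card * ((p ^ x.2.card)⁻¹) ^ 2 *
        ∑ ω, ν ω * cov b x (ω ∩ W) ^ 2) := by
    intro b x hx
    have h1 := (hρ b x hx).ne'
    simp only [hf, hc, Finset.insert_erase (mem_edgePairs.1 hx).2.2.2, Finset.mul_sum]
    refine Finset.sum_congr rfl fun ω _ => ?_
    simp only [hcov]
    field_simp
  have hf0 : ∀ b, ∀ x ∈ edgePairs H W b, 0 ≤ f b x := by
    intro b x hx
    refine nonneg_of_mul_nonneg_right (b := f b x) (a := inclProb n m (x.2.erase b).card) ?_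
      (hρ b x hx)
    rw [hfeq b x hx]
    exact mul_nonneg ht0.le (mul_nonneg (mul_nonneg (hdw b x hx) (by positivity))
      (Finset.sum_nonneg fun ω _ => mul_nonneg (hν ω) (sq_nonneg _)))
  have hJW : ∀ b, ∀ x ∈ edgePairs H W b, x.2.erase b ⊆ Wᶜ := fun b x hx =>
    (Finset.erase_subset _ _).trans (Finset.subset_compl_iff_disjoint_right.2 (hdisj b x hx))
  by_contra! hcon
  have hstep : ∀ W' ∈ Wᶜ.powersetCard m,
      (∑ b ∈ Wᶜ, if b ∉ W' then 1 / (2 * p) *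
        (2 * ∑ x ∈ edgePairs H W b, (if x.2.erase b ⊆ W' then 1 else 0) * f b x -
          ∑ x ∈ edgePairs H W b, ∑ y ∈ edgePairs H W b,
            (if x.2.erase b ∪ y.2.erase b ⊆ W' then 1 else 0) * g b x y) else 0) <
        γ * p * v + m * (p / (1 - p)) := by
    intro W' hW'
    obtain ⟨hsub, hc'⟩ := Finset.mem_powersetCard.1 hW'
    have h1 := hcon W' hsub (by
      rw [hc']
      exact hmle.trans (mul_le_mul_of_nonneg_left hnv hτ0.le))
    rw [HW_eq, HW_eq, Finset.compl_union, ← Finset.sdiff_eq_inter_compl,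
      ← Finset.sum_sdiff hsub] at h1
    have h2 : ∑ b ∈ W', ∑ ω, ν ω * ip p (cexp ν W (ω ∩ W) {b}) ≤ m * (p / (1 - p)) := by
      rw [← hc', ← nsmul_eq_mul]
      refine Finset.sum_le_card_nsmul _ _ _ fun b hb => ?_
      have hbW : b ∉ W := Finset.mem_compl.1 (hsub hb)
      calc _ ≤ ∑ ω, ν ω * (p / (1 - p)) := Finset.sum_le_sum fun ω _ =>
            mul_le_mul_of_nonneg_left (ip_le_div hp0 hp1 (cexp_nonneg ν hν _ _ _)
              (by simpa using cexp_le_pow ν hdown hν hp0.le W (ω ∩ W) {b} (by simpa using hbW)))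
              (hν ω)
        _ = p / (1 - p) := by rw [← Finset.sum_mul, hν1, one_mul]
    have h3 : (∑ b ∈ Wᶜ, if b ∉ W' then 1 / (2 * p) *
        (2 * ∑ x ∈ edgePairs H W b, (if x.2.erase b ⊆ W' then 1 else 0) * f b x -
          ∑ x ∈ edgePairs H W b, ∑ y ∈ edgePairs H W b,
            (if x.2.erase b ∪ y.2.erase b ⊆ W' then 1 else 0) * g b x y) else 0) ≤
        ∑ b ∈ Wᶜ \ W', (∑ ω, ν ω * ip p (cexp ν (W ∪ W') (ω ∩ (W ∪ W')) {b}) -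
          ∑ ω, ν ω * ip p (cexp ν W (ω ∩ W) {b})) := by
      rw [← Finset.sum_filter, ← Finset.sdiff_eq_filter]
      refine Finset.sum_le_sum fun b hb => ?_
      obtain ⟨hb1, hb2⟩ := Finset.mem_sdiff.1 hb
      exact entropy_gain_of_indicators ν hdown hν hν1 hp0 hp1 W W' (Finset.mem_compl.1 hb1)
        hb2 (edgePairs H W b) (fun x => x.2.erase b) (c b) (C b) (hcC b)
    rw [Finset.sum_sub_distrib] at h3
    linarith
  have hN : 0 < (n.choose m : ℝ) := by exact_mod_cast Nat.choose_pos hmn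
  have hupper := Finset.sum_lt_sum_of_nonempty
    (Finset.powersetCard_nonempty.2 (by omega : m ≤ Wᶜ.card)) hstep
  rw [Finset.sum_const, Finset.card_powersetCard, ← hn, nsmul_eq_mul, Finset.sum_comm] at hupper
  have hlower : ∀ b ∈ Wᶜ, _ := fun b hb => sum_powersetCard_gain (U := Wᶜ) (m := m)
    (by omega) hb (by positivity : 0 ≤ 1 / (2 * p)) (edgePairs H W b) (fun x => x.2.erase b)
    (hJW b) (fun x _ => Finset.notMem_erase b _)
    (fun x hx y hy => by
      have h1 := hcard b x hx
      have h2 := hcard b y hy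
      have h3 := Finset.card_union_le (x.2.erase b) (y.2.erase b)
      omega)
    (f b) (hf0 b) (g b)
    (fun x hx y hy => mul_nonneg (mul_nonneg (hC0 b x hx) (hC0 b y hy)) (by positivity))
  have hlow := (Finset.sum_le_sum hlower).trans_lt hupper
  rw [← Finset.mul_sum, ← Finset.mul_sum, ← hn, mul_lt_mul_iff_right₀ hN,
    Finset.sum_sub_distrib] at hlow
  have hfirst : ∑ b ∈ Wᶜ, ∑ x ∈ edgePairs H W b, inclProb n m (x.2.erase b).card * f b x =
      t * errW H d r p η W := by
    rw [errW_eq, Finset.mul_sum]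
    refine Finset.sum_congr rfl fun b _ => ?_
    rw [Finset.mul_sum]
    exact Finset.sum_congr rfl fun x hx => hfeq b x hx
  have hsecond : ∑ b ∈ Wᶜ, ∑ x ∈ edgePairs H W b, ∑ y ∈ edgePairs H W b,
      inclProb n m (x.2.erase b ∪ y.2.erase b).card * g b x y ≤
      t ^ 2 * (p ^ 2)⁻¹ * (3 * D) * (r * eTot H d) := by
    calc _ ≤ ∑ b ∈ Wᶜ, t ^ 2 * (p ^ 2)⁻¹ * (3 * D) *
          ∑ x ∈ edgePairs H W b, d x.1 * pairWeight r x.2.card :=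
          Finset.sum_le_sum fun b _ => second_moment_le hr hunif hd hp0 (half_pos hτ0)
            (by positivity) hmn h2r hθ (fun s hs1 hs2 B hB => by
              refine (hΔ s hs1 hs2 B hB).trans (le_of_eq ?_)
              rw [hlam, hD, show τ / 2 / (r : ℝ) = τ / (2 * r) by rw [div_div], mul_right_comm]) W b t
      _ ≤ _ := by
          rw [← Finset.mul_sum]
          exact mul_le_mul_of_nonneg_left (sum_sum_edgePairs_le hunif hd W _) (by positivity)
  have hmain : 1 / (2 * p) * (t * (β * eTot H d) -
      t ^ 2 * (p ^ 2)⁻¹ * (3 * D) * (r * eTot H d)) < γ * p * v + m * (p / (1 - p)) := by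
    refine lt_of_le_of_lt (mul_le_mul_of_nonneg_left (sub_le_sub ?_ hsecond) ?_) hlow
    · rw [hfirst]
      exact mul_le_mul_of_nonneg_left hEW.le ht0.le
    · positivity
  have hK0 : 0 < K := by linarith
  have hloss : (m : ℝ) * (p / (1 - p)) ≤ γ * p * v / 2 := by
    have h1 : p / (1 - p) ≤ p / (1 - p₀) := by
      gcongr
    have h2 : (m : ℝ) ≤ τ * v := hmle.trans (mul_le_mul_of_nonneg_left hnv hτ0.le)
    calc (m : ℝ) * (p / (1 - p)) ≤ τ * v * (p / (1 - p₀)) := by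
          refine mul_le_mul h2 h1 (div_nonneg hp0.le (by linarith)) (by positivity)
      _ = α * (γ * p * v) := by
          have : (1 - p₀) ≠ 0 := by linarith
          rw [hτ]
          field_simp
      _ ≤ _ := by
          linarith [mul_le_mul_of_nonneg_right hα.le (mul_pos (mul_pos hγ0 hp0) hv0).le]
  have hgain : 1 / (2 * p) * (t * (β * eTot H d) -
      t ^ 2 * (p ^ 2)⁻¹ * (3 * D) * (r * eTot H d)) = 25 / 2 * (γ * p * v) := by
    rw [hγ, ht, hD]
    field_simp
    ring
  rw [hgain] at hmain
  linarith [mul_pos (mul_pos hγ0 hp0) hv0]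

end
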